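/- arXiv:1306.4743 — 3 statements merged into one kernel-verified Lean document; each statement's English description precedes it below -/
import Mathlib

section
/- Let h > 0, F > 0 and m, m' ∈ ℝ³ with m_a ≤ m'_a for a = 1, 2, 3. Let Û(m) denote the unique real number U with U > min(m₁, m₂, m₃) and Σ_{a=1}^{3} (max(U − m_a, 0))² = h²/F², and similarly for Û(m'). Then Û(m) ≤ Û(m'); i.e., the upwind update value is a nondecreasing function of each neighboring value. -/
theorem max_sub_zero_sq_le {U V m n : ℝ} (hV : V ≤ U) (hm : m ≤ n) :
    max (V - n) 0 ^ 2 ≤ max (U - m) 0 ^ 2 := by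
  gcongr

theorem max_sub_zero_sq_lt {U V m n : ℝ} (hV : V < U) (hm : m ≤ n) (hU : m < U) :
    max (V - n) 0 ^ 2 < max (U - m) 0 ^ 2 := by
  have hlt : max (V - n) 0 < max (U - m) 0 :=
    lt_max_of_lt_left (max_lt (by linarith) (by linarith))
  exact pow_lt_pow_left₀ hlt (le_max_right _ _) two_ne_zero

/-- Monotonicity of the upwind update. If m ≤ m' componentwise,
then Û(m) ≤ Û(m'). -/
theorem upwind_update_monotone (h F m₁ m₂ m₃ m₁' m₂' m₃' U U' : ℝ)
    (hh : 0 < h) (hF : 0 < F)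
    (hle₁ : m₁ ≤ m₁') (hle₂ : m₂ ≤ m₂') (hle₃ : m₃ ≤ m₃')
    (hU : U > min m₁ (min m₂ m₃) ∧
      max (U - m₁) 0 ^ 2 + max (U - m₂) 0 ^ 2 + max (U - m₃) 0 ^ 2 = h ^ 2 / F ^ 2)
    (hU' : U' > min m₁' (min m₂' m₃') ∧
      max (U' - m₁') 0 ^ 2 + max (U' - m₂') 0 ^ 2 + max (U' - m₃') 0 ^ 2 = h ^ 2 / F ^ 2) :
    U ≤ U' := by
  by_contra! hlt
  have h₁ := max_sub_zero_sq_le hlt.le hle₁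
  have h₂ := max_sub_zero_sq_le hlt.le hle₂
  have h₃ := max_sub_zero_sq_le hlt.le hle₃
  obtain ⟨hmin, hsum⟩ := hU
  obtain ⟨-, hsum'⟩ := hU'
  rw [gt_iff_lt, min_lt_iff, min_lt_iff] at hmin
  rcases hmin with hm | hm | hm
  · linarith [max_sub_zero_sq_lt hlt hle₁ hm]
  · linarith [max_sub_zero_sq_lt hlt hle₂ hm]
  · linarith [max_sub_zero_sq_lt hlt hle₃ hm]
end

section
/- Let h > 0, F > 0 and m₁ ≤ m₂ be real numbers. There is exactly one real U with U > m₁ and (max(U − m₁, 0))² + (max(U − m₂, 0))² = h²/F², and it is given explicitly by: U = m₁ + h/F if m₂ − m₁ ≥ h/F, and U = (m₁ + m₂ + √(2h²/F² − (m₂ − m₁)²)) / 2 if m₂ − m₁ < h/F. -/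
/-- The two-term upwind sum is strictly increasing to the right of `m₁`. -/
theorem strictMonoOn_upwind_sum (m₁ m₂ : ℝ) :
    StrictMonoOn (fun U : ℝ => max (U - m₁) 0 ^ 2 + max (U - m₂) 0 ^ 2) (Set.Ioi m₁) := by
  intro U hU V hV hUV
  have hU' : 0 < U - m₁ := sub_pos.2 hU
  have hV' : 0 < V - m₁ := sub_pos.2 hV
  have h₂ : max (U - m₂) 0 ^ 2 ≤ max (V - m₂) 0 ^ 2 := by gcongr
  have h₁ : (U - m₁) ^ 2 < (V - m₁) ^ 2 := by gcongr
  simp only [max_eq_left hU'.le, max_eq_left hV'.le]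
  exact add_lt_add_of_lt_of_le h₁ h₂

/-- The explicit two-term upwind update solves the upwind equation. -/
theorem upwind_formula_spec {r m₁ m₂ : ℝ} (hr : 0 < r) (hm : m₁ ≤ m₂) {W : ℝ}
    (hW : W = if r ≤ m₂ - m₁ then m₁ + r
      else (m₁ + m₂ + Real.sqrt (2 * r ^ 2 - (m₂ - m₁) ^ 2)) / 2) :
    W > m₁ ∧ max (W - m₁) 0 ^ 2 + max (W - m₂) 0 ^ 2 = r ^ 2 := by
  split_ifs at hW with hle
  · refine ⟨by linarith, ?_⟩
    rw [max_eq_left (by linarith), max_eq_right (by linarith), hW]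
    ring
  · have hlt : m₂ - m₁ < Real.sqrt (2 * r ^ 2 - (m₂ - m₁) ^ 2) :=
      Real.lt_sqrt_of_sq_lt (by nlinarith)
    have hsq : Real.sqrt (2 * r ^ 2 - (m₂ - m₁) ^ 2) ^ 2 = 2 * r ^ 2 - (m₂ - m₁) ^ 2 :=
      Real.sq_sqrt (by nlinarith)
    refine ⟨by linarith, ?_⟩
    rw [max_eq_left (by linarith), max_eq_left (by linarith), hW]
    linear_combination hsq / 2

/-- Two-term upwind update, with explicit formula. For m₁ ≤ m₂ there
is exactly one real U with U > m₁ and (max(U − m₁, 0))² + (max(U − m₂, 0))² = h²/F²,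
and it equals m₁ + h/F if m₂ − m₁ ≥ h/F, and
(m₁ + m₂ + √(2h²/F² − (m₂ − m₁)²))/2 otherwise. -/
theorem upwind_update_two_term (h F m₁ m₂ : ℝ) (hh : 0 < h) (hF : 0 < F)
    (hm : m₁ ≤ m₂) :
    (∃! U : ℝ, U > m₁ ∧ max (U - m₁) 0 ^ 2 + max (U - m₂) 0 ^ 2 = h ^ 2 / F ^ 2) ∧
    (∀ U : ℝ, U > m₁ → max (U - m₁) 0 ^ 2 + max (U - m₂) 0 ^ 2 = h ^ 2 / F ^ 2 →
      U = if h / F ≤ m₂ - m₁ then m₁ + h / F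
          else (m₁ + m₂ + Real.sqrt (2 * h ^ 2 / F ^ 2 - (m₂ - m₁) ^ 2)) / 2) := by
  have hspec := upwind_formula_spec (div_pos hh hF) hm rfl
  rw [div_pow, ← mul_div_assoc] at hspec
  have huniq : ∀ U : ℝ, U > m₁ →
      max (U - m₁) 0 ^ 2 + max (U - m₂) 0 ^ 2 = h ^ 2 / F ^ 2 →
      U = if h / F ≤ m₂ - m₁ then m₁ + h / F
          else (m₁ + m₂ + Real.sqrt (2 * h ^ 2 / F ^ 2 - (m₂ - m₁) ^ 2)) / 2 :=
    fun U hU hEq =>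
      (strictMonoOn_upwind_sum m₁ m₂).injOn hU hspec.1 (hEq.trans hspec.2.symm)
  exact ⟨⟨_, hspec, fun U hU => huniq U hU.1 hU.2⟩, huniq⟩
end

section
/- Let n ≥ 1, X = {0, 1, …, n}³, h > 0, Q ⊆ X nonempty, q : Q → ℝ, F : X → (0, ∞), and let U : X → ℝ solve the discretized Eikonal system. Then for every x ∈ X \ Q, U(x) is strictly greater than the minimum of U over the grid neighbors of x; consequently, the minimum of U over all of X is attained at a point of Q, and min_{x ∈ X} U(x) = min_{x ∈ Q} q(x). -/
/-- The grid X = {0, 1, …, n}³, represented as functions Fin 3 → Fin (n+1). -/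
abbrev Grid (n : ℕ) := Fin 3 → Fin (n + 1)

/-- `y` is a grid neighbor of `x` along axis `a`: they agree in all other
coordinates and differ by exactly 1 in coordinate `a`. -/
def AxisNbr {n : ℕ} (a : Fin 3) (x y : Grid n) : Prop :=
  (∀ b, b ≠ a → y b = x b) ∧ ((y a : ℤ) - (x a : ℤ)).natAbs = 1

/-- m_a(U, x): the minimum of U over the grid neighbors of x along axis a. -/
noncomputable def axMin {n : ℕ} (U : Grid n → ℝ) (x : Grid n) (a : Fin 3) : ℝ :=
  sInf {v | ∃ y : Grid n, AxisNbr a x y ∧ U y = v}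

/-- U solves the discretized Eikonal system with stepsize `hs`, exit set `Q`,
exit penalty `q`, and speed `F`. -/
def SolvesEikonal {n : ℕ} (hs : ℝ) (Q : Set (Grid n)) (q F U : Grid n → ℝ) : Prop :=
  (∀ x ∈ Q, U x = q x) ∧
  ∀ x : Grid n, x ∉ Q →
    ∑ a : Fin 3, max (U x - axMin U x a) 0 ^ 2 = hs ^ 2 / F x ^ 2

/-- `y` is a grid neighbor of `x` (differ by 1 in exactly one coordinate). -/
def IsNbr {n : ℕ} (x y : Grid n) : Prop :=
  ∑ a : Fin 3, ((x a : ℤ) - (y a : ℤ)).natAbs = 1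

/-- The minimum of U over all grid neighbors of x. -/
noncomputable def nbrMin {n : ℕ} (U : Grid n → ℝ) (x : Grid n) : ℝ :=
  sInf {v | ∃ y : Grid n, IsNbr x y ∧ U y = v}

/-- A grid neighbor along one axis is a grid neighbor. -/
theorem AxisNbr.isNbr {n : ℕ} {a : Fin 3} {x y : Grid n} (h : AxisNbr a x y) : IsNbr x y := by
  obtain ⟨h₁, h₂⟩ := h
  unfold IsNbr
  rw [Finset.sum_eq_single a (fun b _ hb => by simp [h₁ b hb]) (by simp)]
  omega

/-- If the grid has at least two points along each axis, every point has a neighbor along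
each axis. -/
theorem exists_axisNbr {n : ℕ} (hn : 1 ≤ n) (a : Fin 3) (x : Grid n) :
    ∃ y : Grid n, AxisNbr a x y := by
  have hx := (x a).isLt
  by_cases h : (x a : ℕ) = 0
  · refine ⟨Function.update x a ⟨1, by omega⟩, fun b hb => by simp [hb], ?_⟩
    simp [h]
  · refine ⟨Function.update x a ⟨(x a : ℕ) - 1, by omega⟩, fun b hb => by simp [hb], ?_⟩
    simp only [Function.update_self]
    omega

/-- Outside the exit set, a solution takes a strictly smaller value at some neighbor. -/
theorem SolvesEikonal.exists_isNbr_lt {n : ℕ} (hn : 1 ≤ n) {hs : ℝ} (hhs : 0 < hs)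
    {Q : Set (Grid n)} {q F U : Grid n → ℝ} (hF : ∀ x, 0 < F x)
    (hU : SolvesEikonal hs Q q F U) {x : Grid n} (hx : x ∉ Q) :
    ∃ y, IsNbr x y ∧ U y < U x := by
  have hpos : 0 < ∑ a : Fin 3, max (U x - axMin U x a) 0 ^ 2 := by
    rw [hU.2 x hx]
    have := hF x
    positivity
  obtain ⟨a, -, ha⟩ := Finset.exists_ne_zero_of_sum_ne_zero hpos.ne'
  have hlt : axMin U x a < U x := by
    by_contra! hle
    exact ha (by simp [max_eq_right (sub_nonpos.2 hle)])
  obtain ⟨z, hz⟩ := exists_axisNbr hn a x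
  obtain ⟨_, ⟨y, hy, rfl⟩, hyx⟩ := exists_lt_of_csInf_lt (by exact ⟨U z, z, hz, rfl⟩) hlt
  exact ⟨y, hy.isNbr, hyx⟩

/-- For a solution U of the discretized Eikonal system, U(x) is
strictly greater than the minimum of U over the neighbors of x for x ∉ Q;
consequently the minimum of U over X is attained at a point of Q, and
min_{x ∈ X} U(x) = min_{x ∈ Q} q(x). -/
theorem eikonal_min_attained_on_exit_set (n : ℕ) (hn : 1 ≤ n) (hs : ℝ) (hhs : 0 < hs)
    (Q : Set (Grid n)) (hQ : Q.Nonempty) (q F U : Grid n → ℝ) (hF : ∀ x, 0 < F x)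
    (hU : SolvesEikonal hs Q q F U) :
    (∀ x : Grid n, x ∉ Q → nbrMin U x < U x) ∧
    (∃ x₀ ∈ Q, ∀ x : Grid n, U x₀ ≤ U x) ∧
    sInf (Set.range U) = sInf (q '' Q) := by
  have hbdd : BddBelow (Set.range U) := (Set.finite_range U).bddBelow
  have hmin : ∃ x₀ ∈ Q, ∀ x : Grid n, U x₀ ≤ U x := by
    obtain ⟨x₀, hx₀⟩ := Finite.exists_min U
    refine ⟨x₀, ?_, hx₀⟩
    by_contra hmem
    obtain ⟨y, -, hy⟩ := hU.exists_isNbr_lt hn hhs hF hmem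
    exact (hx₀ y).not_gt hy
  refine ⟨fun x hx => ?_, hmin, ?_⟩
  · obtain ⟨y, hy, hyx⟩ := hU.exists_isNbr_lt hn hhs hF hx
    refine lt_of_le_of_lt (csInf_le (hbdd.mono ?_) (by exact ⟨y, hy, rfl⟩)) hyx
    rintro _ ⟨z, -, rfl⟩
    exact ⟨z, rfl⟩
  · obtain ⟨x₀, hx₀, hle⟩ := hmin
    have hrange : IsLeast (Set.range U) (U x₀) :=
      ⟨⟨x₀, rfl⟩, by rintro _ ⟨x, rfl⟩; exact hle x⟩
    have himage : IsLeast (q '' Q) (U x₀) :=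
      ⟨⟨x₀, hx₀, (hU.1 x₀ hx₀).symm⟩, by rintro _ ⟨x, hx, rfl⟩; exact hU.1 x hx ▸ hle x⟩
    rw [hrange.csInf_eq, himage.csInf_eq]
end
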